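/- Let n ∈ ℕ. Let A : ℝ → Matrix (Fin n) (Fin n) ℂ and b : ℝ → (Fin n → ℂ) be differentiable (over ℝ) at α₀, let x : ℝ → (Fin n → ℂ) be differentiable at α₀ and satisfy A(α) ·ᵥ x(α) = b(α) for all α in a neighborhood of α₀, and suppose A(α₀) is invertible. Let 𝒥 : (Fin n → ℂ) → ℝ be Fréchet differentiable over ℝ at x(α₀), with ∇ₓ𝒥 ∈ Fin n → ℂ defined componentwise by (∇ₓ𝒥)_j = D𝒥(x(α₀))(e_j) + i·D𝒥(x(α₀))(i·e_j), and let γ ∈ Fin n → ℂ solve the adjoint problem A(α₀)ᴴ ·ᵥ γ = ∇ₓ𝒥. Then (d/dα)𝒥(x(α))|_{α₀} = Re( ∑_i conj(γ_i) · ( b'(α₀) − A'(α₀) ·ᵥ x(α₀) )_i ). -/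

import Mathlib

open Matrix

attribute [local instance] Matrix.normedAddCommGroup Matrix.normedSpace

/-- the adjoint sensitivity formula (adj_sens) of the paper: if
`A(α) x(α) = b(α)` near `α₀`, `A(α₀)` is invertible, `𝒥` is real-Fréchet differentiable at
`x(α₀)` with complex gradient `(∇ₓ𝒥)_j = D𝒥(e_j) + i·D𝒥(i·e_j)`, and `γ` solves the adjoint
problem `A(α₀)ᴴ γ = ∇ₓ𝒥`, then
`(d/dα)𝒥(x(α))|_{α₀} = Re(∑ i, conj(γ_i)·(b'(α₀) − A'(α₀) x(α₀))_i)`. -/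
theorem adjoint_sensitivity_formula
    (n : ℕ) (A : ℝ → Matrix (Fin n) (Fin n) ℂ) (b x : ℝ → (Fin n → ℂ)) (α₀ : ℝ)
    (hA : DifferentiableAt ℝ A α₀) (hb : DifferentiableAt ℝ b α₀)
    (hx : DifferentiableAt ℝ x α₀)
    (hstate : ∀ᶠ α in nhds α₀, (A α) *ᵥ (x α) = b α)
    (hinv : IsUnit (A α₀).det)
    (J : (Fin n → ℂ) → ℝ) (hJ : DifferentiableAt ℝ J (x α₀))
    (γ : Fin n → ℂ)
    (hadj : (A α₀)ᴴ *ᵥ γ = fun j =>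
      ((fderiv ℝ J (x α₀) (Pi.single j 1 : Fin n → ℂ) : ℝ) : ℂ)
        + Complex.I * ((fderiv ℝ J (x α₀) (Complex.I • (Pi.single j 1 : Fin n → ℂ)) : ℝ) : ℂ)) :
    HasDerivAt (fun α => J (x α))
      ((∑ i, (starRingEnd ℂ) (γ i) * (deriv b α₀ - (deriv A α₀) *ᵥ (x α₀)) i).re) α₀ := by
  have hA1 : ∀ i j, HasDerivAt (fun α => A α i j) (deriv A α₀ i j) α₀ := by
    intro i j
    have h1 : HasDerivAt (fun α => A α i) (deriv A α₀ i) α₀ :=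
      (hasDerivAt_pi (φ := fun α i => A α i) (φ' := fun i => deriv A α₀ i)).1 hA.hasDerivAt i
    exact hasDerivAt_pi.1 h1 j
  have hx1 : ∀ j, HasDerivAt (fun α => x α j) (deriv x α₀ j) α₀ :=
    hasDerivAt_pi.1 hx.hasDerivAt
  have hb1 : ∀ j, HasDerivAt (fun α => b α j) (deriv b α₀ j) α₀ :=
    hasDerivAt_pi.1 hb.hasDerivAt
  have key : deriv b α₀ - (deriv A α₀) *ᵥ (x α₀) = A α₀ *ᵥ deriv x α₀ := by
    funext i
    have h1 : HasDerivAt (fun α => ∑ j, A α i j * x α j)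
        (∑ j, (deriv A α₀ i j * x α₀ j + A α₀ i j * deriv x α₀ j)) α₀ :=
      HasDerivAt.fun_sum fun j _ => (hA1 i j).mul (hx1 j)
    have h2 : (fun α => b α i) =ᶠ[nhds α₀] (fun α => ∑ j, A α i j * x α j) := by
      filter_upwards [hstate] with α hα
      rw [← hα]; rfl
    have h3 := (hb1 i).unique (h1.congr_of_eventuallyEq h2)
    rw [Pi.sub_apply, h3, Finset.sum_add_distrib]
    simp only [Matrix.mulVec, dotProduct]
    ring
  have hd : HasDerivAt (fun α => J (x α)) (fderiv ℝ J (x α₀) (deriv x α₀)) α₀ :=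
    hJ.hasFDerivAt.comp_hasDerivAt α₀ hx.hasDerivAt
  convert hd using 1
  rw [key]
  have e1 : ∑ i, (starRingEnd ℂ) (γ i) * (A α₀ *ᵥ deriv x α₀) i
      = star ((A α₀)ᴴ *ᵥ γ) ⬝ᵥ deriv x α₀ := by
    rw [Matrix.star_mulVec, Matrix.conjTranspose_conjTranspose, ← Matrix.dotProduct_mulVec]
    rfl
  rw [e1, hadj]
  generalize deriv x α₀ = v
  generalize fderiv ℝ J (x α₀) = L
  have e2 : v = ∑ j, ((v j).re • (Pi.single j 1 : Fin n → ℂ)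
      + (v j).im • (Complex.I • (Pi.single j 1 : Fin n → ℂ))) := by
    funext k
    rw [Finset.sum_apply, Finset.sum_eq_single k]
    · simp [Complex.re_add_im]
    · intro j _ hj
      simp [hj.symm]
    · simp
  conv_rhs => rw [e2]
  rw [map_sum, dotProduct, Complex.re_sum]
  refine Finset.sum_congr rfl fun j _ => ?_
  rw [map_add, map_smul, map_smul]
  simp [Complex.mul_re]
  ring
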